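/- arXiv:1512.00683 — 2 statements merged into one kernel-verified Lean document; each statement's English description precedes it below -/
import Mathlib

section
/- Let X be a real normed vector space, let φ ∈ X, and let σ_1, …, σ_M be continuous linear functionals on X each of operator norm at most 1. Let q_1, …, q_M ∈ X be such that |σ_j(q_i)| ≤ 1 for all i < j. Define real numbers α_1, …, α_M recursively by α_j = σ_j(φ) − Σ_{i=1}^{j−1} α_i σ_j(q_i). Then for every 1 ≤ j ≤ M, |α_j| ≤ 2^{j−1} ‖φ‖. -/
theorem Fin.sum_filter_lt_two_pow {M : ℕ} (j : Fin M) :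
    ∑ i ∈ Finset.univ.filter (fun i : Fin M => i < j), (2 : ℝ) ^ (i : ℕ) = 2 ^ (j : ℕ) - 1 := by
  have hmap : (Finset.univ.filter (fun i : Fin M => i < j)).map Fin.valEmbedding =
      Finset.range j := by
    ext k
    simp only [Finset.mem_map, Finset.mem_filter, Finset.mem_univ, true_and, Fin.valEmbedding_apply,
      Finset.mem_range]
    exact ⟨fun ⟨i, hi, hk⟩ => hk ▸ hi, fun hk => ⟨⟨k, hk.trans j.isLt⟩, hk, rfl⟩⟩
  have hsum := geom_sum_eq (show (2 : ℝ) ≠ 1 by norm_num) j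
  rw [← hmap, Finset.sum_map] at hsum
  simp only [Fin.valEmbedding_apply] at hsum
  rw [hsum]
  norm_num

/-- Bound on the coefficients of the generalized interpolant obtained by forward
substitution: if `‖σ j‖ ≤ 1` and `|σ j (q i)| ≤ 1` for `i < j`, and
`α j = σ j φ − Σ_{i<j} α i · σ j (q i)`, then `|α j| ≤ 2^(j−1) ‖φ‖`
(with the zero-based index `j`, the bound reads `2 ^ (j : ℕ)`). -/
theorem geim_stmt7 {X : Type*} [NormedAddCommGroup X] [NormedSpace ℝ X] {M : ℕ}
    (φ : X) (σ : Fin M → X →L[ℝ] ℝ) (hσ : ∀ j : Fin M, ‖σ j‖ ≤ 1)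
    (q : Fin M → X) (hq : ∀ i j : Fin M, i < j → |σ j (q i)| ≤ 1)
    (α : Fin M → ℝ)
    (hα : ∀ j : Fin M,
      α j = σ j φ - ∑ i ∈ Finset.univ.filter (fun i : Fin M => i < j), α i * σ j (q i)) :
    ∀ j : Fin M, |α j| ≤ 2 ^ (j : ℕ) * ‖φ‖ := by
  intro j
  induction j using WellFoundedLT.induction with
  | ind j ih =>
    have hφ : |σ j φ| ≤ ‖φ‖ := by
      simpa using (σ j).le_of_opNorm_le (hσ j) φ
    have hsum : |∑ i ∈ Finset.univ.filter (fun i : Fin M => i < j), α i * σ j (q i)| ≤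
        (2 ^ (j : ℕ) - 1) * ‖φ‖ := by
      rw [← Fin.sum_filter_lt_two_pow, Finset.sum_mul]
      refine (Finset.abs_sum_le_sum_abs _ _).trans (Finset.sum_le_sum fun i hi => ?_)
      have hij : i < j := (Finset.mem_filter.mp hi).2
      rw [abs_mul]
      exact (mul_le_of_le_one_right (abs_nonneg _) (hq i j hij)).trans (ih i hij)
    rw [hα j]
    linarith [abs_sub (σ j φ)
      (∑ i ∈ Finset.univ.filter (fun i : Fin M => i < j), α i * σ j (q i))]
end

section
/- Let X be a real normed vector space, let φ ∈ X, and let σ_1, …, σ_M be continuous linear functionals on X each of operator norm at most 1. Let q_1, …, q_M ∈ X be such that |σ_j(q_i)| ≤ 1 for all i < j, and define α_1, …, α_M recursively by α_j = σ_j(φ) − Σ_{i=1}^{j−1} α_i σ_j(q_i). Then the generalized interpolant J_M[φ] = Σ_{j=1}^M α_j q_j satisfies ‖J_M[φ]‖ ≤ (Σ_{j=1}^M 2^{j−1} ‖q_j‖) · ‖φ‖; in particular ‖J_M[φ]‖ ≤ (2^M − 1) · (max_{1≤j≤M} ‖q_j‖) · ‖φ‖, giving an a priori bound on the Lebesgue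 constant Λ_M of the GEIM. -/
theorem Fin.sum_univ_filter_lt {β : Type*} [AddCommMonoid β] {M : ℕ} (f : ℕ → β) (j : Fin M) :
    ∑ i ∈ Finset.univ.filter (fun i : Fin M => i < j), f i = ∑ k ∈ Finset.range j, f k := by
  refine Finset.sum_bij (fun i _ => (i : ℕ)) ?_ ?_ ?_ ?_
  · intro i hi
    simpa using hi
  · intro a _ b _ h
    exact Fin.ext h
  · intro k hk
    have hk' : k < j := Finset.mem_range.mp hk
    exact ⟨⟨k, hk'.trans j.isLt⟩, Finset.mem_filter.mpr ⟨Finset.mem_univ _, hk'⟩, rfl⟩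
  · intro i _
    rfl

theorem sum_range_two_pow (n : ℕ) : ∑ k ∈ Finset.range n, (2 : ℝ) ^ k = 2 ^ n - 1 := by
  rw [geom_sum_eq (by norm_num)]
  norm_num

/-- Discrete Gronwall inequality for forward substitution: a sequence bounded by `C` plus the sum
of its previous absolute values grows at most like `2 ^ j * C`. -/
theorem abs_le_two_pow_mul_of_le_add_sum {M : ℕ} {a : Fin M → ℝ} {C : ℝ}
    (h : ∀ j, |a j| ≤ C + ∑ i ∈ Finset.univ.filter (fun i : Fin M => i < j), |a i|)
    (j : Fin M) : |a j| ≤ 2 ^ (j : ℕ) * C := by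
  induction j using WellFoundedLT.induction with
  | ind j ih =>
    calc |a j| ≤ C + ∑ i ∈ Finset.univ.filter (fun i : Fin M => i < j), |a i| := h j
      _ ≤ C + ∑ i ∈ Finset.univ.filter (fun i : Fin M => i < j), 2 ^ (i : ℕ) * C := by
        gcongr with i hi
        exact ih i (Finset.mem_filter.mp hi).2
      _ = 2 ^ (j : ℕ) * C := by
        rw [Fin.sum_univ_filter_lt (fun k => 2 ^ k * C) j, ← Finset.sum_mul, sum_range_two_pow]
        ring

/-- A priori bound on the GEIM Lebesgue constant: with `‖σ j‖ ≤ 1`, `|σ j (q i)| ≤ 1`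
for `i < j`, and coefficients `α j = σ j φ − Σ_{i<j} α i σ j (q i)` obtained by forward
substitution, the generalized interpolant `J_M[φ] = Σ_j α j • q j` satisfies
`‖J_M[φ]‖ ≤ (Σ_j 2^(j−1) ‖q j‖) ‖φ‖ ≤ (2^M − 1) (max_j ‖q j‖) ‖φ‖`
(zero-based indices: `2 ^ (j : ℕ)`). -/
theorem geim_stmt8 {X : Type*} [NormedAddCommGroup X] [NormedSpace ℝ X] {M : ℕ}
    (φ : X) (σ : Fin M → X →L[ℝ] ℝ) (hσ : ∀ j : Fin M, ‖σ j‖ ≤ 1)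
    (q : Fin M → X) (hq : ∀ i j : Fin M, i < j → |σ j (q i)| ≤ 1)
    (α : Fin M → ℝ)
    (hα : ∀ j : Fin M,
      α j = σ j φ - ∑ i ∈ Finset.univ.filter (fun i : Fin M => i < j), α i * σ j (q i)) :
    ‖∑ j : Fin M, α j • q j‖ ≤ (∑ j : Fin M, 2 ^ (j : ℕ) * ‖q j‖) * ‖φ‖ ∧
      ‖∑ j : Fin M, α j • q j‖ ≤ ((2 : ℝ) ^ M - 1) * (⨆ j : Fin M, ‖q j‖) * ‖φ‖ := by
  have hα_le : ∀ j, |α j| ≤ 2 ^ (j : ℕ) * ‖φ‖ := by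
    refine abs_le_two_pow_mul_of_le_add_sum fun j => ?_
    rw [hα j]
    refine (abs_sub _ _).trans (add_le_add ?_ ?_)
    · exact (σ j).le_of_opNorm_le (hσ j) φ |>.trans_eq (one_mul _)
    · refine (Finset.abs_sum_le_sum_abs _ _).trans (Finset.sum_le_sum fun i hi => ?_)
      rw [abs_mul]
      exact mul_le_of_le_one_right (abs_nonneg _) (hq i j (Finset.mem_filter.mp hi).2)
  have hsum : ‖∑ j : Fin M, α j • q j‖ ≤ (∑ j : Fin M, 2 ^ (j : ℕ) * ‖q j‖) * ‖φ‖ := by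
    rw [Finset.sum_mul]
    refine norm_sum_le_of_le _ fun j _ => ?_
    rw [norm_smul, Real.norm_eq_abs, mul_right_comm]
    exact mul_le_mul_of_nonneg_right (hα_le j) (norm_nonneg _)
  refine ⟨hsum, hsum.trans (mul_le_mul_of_nonneg_right ?_ (norm_nonneg _))⟩
  rw [← sum_range_two_pow, ← Fin.sum_univ_eq_sum_range, Finset.sum_mul]
  gcongr with j
  exact le_ciSup (f := fun j => ‖q j‖) (Set.finite_range _).bddAbove j
end
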